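/- Let α ∉ {−1,−2,−3,…} be a real number and 𝓕 = (F_1,F_2) a pair of finite sets of positive integers, not both empty. For every n ∈ σ_𝓕 and every real x with Ω_𝓕^α(x) ≠ 0, writing y = L_n^{α;𝓕} and Ω = Ω_𝓕^α, one has x·y''(x) + (α+k+1−x−2x·Ω'(x)/Ω(x))·y'(x) + (−k_1−u_𝓕+(x−α−k)·Ω'(x)/Ω(x)+x·Ω''(x)/Ω(x))·y(x) = −n·y(x). -/

import Mathlib

open Finset MeasureTheory Polynomial

/-- Generalized binomial coefficient `C(t, j) = t(t-1)⋯(t-j+1)/j!`. -/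
noncomputable def gbinom (t : ℝ) (j : ℕ) : ℝ :=
  (∏ i ∈ Finset.range j, (t - i)) / (Nat.factorial j)

/-- Pochhammer symbol `(t)_m = t(t+1)⋯(t+m-1)`. -/
noncomputable def poch (t : ℝ) (m : ℕ) : ℝ := ∏ i ∈ Finset.range m, (t + i)

/-- Pochhammer symbol with integer index (Γ-quotient convention for negative index). -/
noncomputable def pochZ (t : ℝ) (m : ℤ) : ℝ :=
  if 0 ≤ m then ∏ i ∈ Finset.range m.toNat, (t + i)
  else (∏ i ∈ Finset.range (-m).toNat, (t - (i + 1)))⁻¹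

/-- `ĉ = max(-⌊c⌋, 0)`. -/
noncomputable def chat (c : ℝ) : ℕ := (-⌊c⌋).toNat

/-- Admissibility of `c` and the pair `𝓕 = (F₁, F₂)`. -/
def IsAdmissible (c : ℝ) (F1 F2 : Finset ℕ) : Prop :=
  ∀ x : ℕ, 0 ≤ (∏ f ∈ F1, ((x : ℝ) - f)) * (∏ f ∈ F2, ((x : ℝ) + c + f)) /
    poch ((x : ℝ) + c) (chat c)

/-- `u_𝓕 = ∑_{f∈F₁} f + ∑_{f∈F₂} f - C(k₁+1, 2) - C(k₂, 2)`. -/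
def uF (F1 F2 : Finset ℕ) : ℕ :=
  (∑ f ∈ F1, f + ∑ f ∈ F2, f) - (Nat.choose (F1.card + 1) 2 + Nat.choose F2.card 2)

/-- `σ_𝓕 = {u_𝓕, u_𝓕+1, …} \ {u_𝓕 + f : f ∈ F₁}`. -/
def sigmaF (F1 F2 : Finset ℕ) : Set ℕ :=
  {n | uF F1 F2 ≤ n ∧ ∀ f ∈ F1, n ≠ uF F1 F2 + f}

/-- The `i`-th element (0-based) of `F` in increasing order. -/
def nth (F : Finset ℕ) (i : ℕ) : ℕ := (F.sort (· ≤ ·)).getD i 0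
/-- The Laguerre polynomial `L_n^α` as a real polynomial. -/
noncomputable def lag (α : ℝ) (n : ℕ) : Polynomial ℝ :=
  ∑ j ∈ Finset.range (n + 1),
    Polynomial.C ((-1 : ℝ) ^ j / (Nat.factorial j : ℝ) * gbinom ((n : ℝ) + α) (n - j)) *
      Polynomial.X ^ j

/-- `j`-th derivative of a real polynomial. -/
noncomputable def iterDeriv (j : ℕ) (p : Polynomial ℝ) : Polynomial ℝ :=
  (fun q => Polynomial.derivative q)^[j] p

/-- The polynomial `L_n^{α;𝓕}` (Wronskian type determinant of Laguerre polynomials). -/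
noncomputable def lagExc (α : ℝ) (F1 F2 : Finset ℕ) (n : ℕ) : Polynomial ℝ :=
  Matrix.det (Matrix.of fun i j : Fin (F1.card + F2.card + 1) =>
    if (i : ℕ) = 0 then iterDeriv (j : ℕ) (lag α (n - uF F1 F2))
    else if (i : ℕ) - 1 < F1.card then iterDeriv (j : ℕ) (lag α (nth F1 ((i : ℕ) - 1)))
    else (lag (α + ((j : ℕ) : ℝ)) (nth F2 ((i : ℕ) - 1 - F1.card))).comp (-Polynomial.X))

/-- The Wronskian type determinant `Ω_𝓕^α` as a real polynomial. -/
noncomputable def OmegaL (α : ℝ) (F1 F2 : Finset ℕ) : Polynomial ℝ :=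
  Matrix.det (Matrix.of fun i j : Fin (F1.card + F2.card) =>
    if (i : ℕ) < F1.card then iterDeriv (j : ℕ) (lag α (nth F1 (i : ℕ)))
    else (lag (α + ((j : ℕ) : ℝ)) (nth F2 ((i : ℕ) - F1.card))).comp (-Polynomial.X))

/-! ### Determinants built from sequences -/

noncomputable def dt {N : ℕ} (r : Fin N → ℕ → ℝ[X]) (c : Fin N → ℕ) : ℝ[X] :=
  Matrix.det (Matrix.of fun i j => r i (c j))

lemma dt_update {N : ℕ} (r : Fin N → ℕ → ℝ[X]) (c : Fin N → ℕ) (j : Fin N) (m : ℕ) :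
    dt r (Function.update c j m) =
      ((Matrix.of fun i j => r i (c j)).updateCol j (fun i => r i m)).det := by
  unfold dt
  congr 1
  ext1 i l
  by_cases h : l = j
  · subst h; simp
  · simp [h]

lemma dt_eq_zero {N : ℕ} (r : Fin N → ℕ → ℝ[X]) (c : Fin N → ℕ) {i j : Fin N} (hij : i ≠ j)
    (h : c i = c j) : dt r c = 0 :=
  Matrix.det_zero_of_column_eq hij (by intro l; simp [h])

lemma dt_swap {N : ℕ} (r : Fin N → ℕ → ℝ[X]) (c : Fin N → ℕ) {i j : Fin N} (hij : i ≠ j) :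
    dt r (c ∘ Equiv.swap i j) = - dt r c := by
  have := Matrix.det_permute' (Equiv.swap i j) (Matrix.of fun i j => r i (c j))
  rw [Equiv.Perm.sign_swap hij] at this
  simpa [dt, Matrix.submatrix] using this

lemma sum_det_updateCol {N : ℕ} (M B : Matrix (Fin N) (Fin N) ℝ[X]) :
    ∑ j, (M.updateCol j (fun i => B i j)).det = (M.adjugate * B).trace := by
  simp only [Matrix.trace, Matrix.diag]
  refine Finset.sum_congr rfl fun j _ => ?_
  rw [← Matrix.cramer_apply, Matrix.cramer_eq_adjugate_mulVec]
  rfl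

lemma sum_det_eigen {N : ℕ} (M : Matrix (Fin N) (Fin N) ℝ[X]) (t : Fin N → ℝ[X]) :
    ∑ j, (M.updateCol j (fun i => t i * M i j)).det = (∑ i, t i) * M.det := by
  have h := sum_det_updateCol M (Matrix.diagonal t * M)
  simp only [Matrix.diagonal_mul] at h
  rw [h, ← mul_assoc, Matrix.trace_mul_comm, ← mul_assoc, Matrix.mul_adjugate]
  simp [Matrix.trace, Finset.sum_mul, mul_comm]

lemma derivative_det {N : ℕ} (M : Matrix (Fin N) (Fin N) ℝ[X]) :
    derivative M.det = ∑ j, (M.updateCol j (fun i => derivative (M i j))).det := by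
  simp only [Matrix.det_apply, map_sum]
  rw [Finset.sum_comm]
  refine Finset.sum_congr rfl fun σ _ => ?_
  rw [← Finset.smul_sum, Units.smul_def, Units.smul_def, map_zsmul, Polynomial.derivative_prod_finset]
  congr 1
  refine Finset.sum_congr rfl fun j _ => ?_
  rw [← Finset.mul_prod_erase _ _ (Finset.mem_univ j), mul_comm]
  congr 1
  · simp
  · refine Finset.prod_congr rfl fun l hl => ?_
    simp [Finset.ne_of_mem_erase hl]

lemma derivative_dt {N : ℕ} (r : Fin N → ℕ → ℝ[X]) (c : Fin N → ℝ)
    (hD : ∀ i j, derivative (r i j) = r i (j + 1) - C (c i) * r i j) (e : Fin N → ℕ) :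
    derivative (dt r e) = ∑ j, dt r (Function.update e j (e j + 1)) - C (∑ i, c i) * dt r e := by
  have h := sum_det_eigen (Matrix.of fun i j => r i (e j)) (fun i => C (c i))
  rw [← map_sum] at h
  unfold dt at *
  rw [← h, derivative_det, ← Finset.sum_sub_distrib]
  refine Finset.sum_congr rfl fun j _ => ?_
  have h2 := dt_update r e j (e j + 1)
  unfold dt at h2
  rw [h2]
  simp only [Matrix.of_apply, hD]
  rw [eq_sub_iff_add_eq, ← Matrix.det_updateCol_add]
  congr 2
  ext1 i
  simp

section generic
variable {m : ℕ} (r : Fin (m + 1) → ℕ → ℝ[X])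

noncomputable def A0 : ℝ[X] := dt r (fun j => (j : ℕ))
noncomputable def A1 : ℝ[X] := dt r (Function.update (fun j => (j : ℕ)) (Fin.last m) (m + 1))
noncomputable def A2 : ℝ[X] := dt r (Function.update (fun j => (j : ℕ)) (Fin.last m) (m + 2))
noncomputable def Sj (j : Fin m) : ℝ[X] :=
  dt r (Function.update (fun j => (j : ℕ)) j.castSucc ((j : ℕ) + 2))

lemma succ_zero (j : Fin m) :
    dt r (Function.update (fun j => (j : ℕ)) j.castSucc ((j : ℕ) + 1)) = 0 := by
  refine dt_eq_zero r _ (i := j.castSucc) (j := j.succ) (Fin.castSucc_lt_succ).ne ?_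
  rw [Function.update_self, Function.update_of_ne (Fin.castSucc_lt_succ).ne']
  simp

lemma Sj_zero (j : Fin m) (h : (j : ℕ) + 1 < m) : Sj r j = 0 := by
  have hne : j.castSucc ≠ (⟨j + 2, by omega⟩ : Fin (m+1)) := by
    intro h; have := congrArg Fin.val h; simp at this
  refine dt_eq_zero r _ hne ?_
  rw [Function.update_self, Function.update_of_ne hne.symm]

lemma Sj_eq (j : Fin m) :
    dt r (Function.update (Function.update (fun j => (j : ℕ)) (Fin.last m) (m + 1))
      j.castSucc ((j : ℕ) + 1)) = - Sj r j := by
  rcases Nat.lt_or_ge ((j : ℕ) + 1) m with h | h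
  · rw [Sj_zero r j h, neg_zero]
    refine dt_eq_zero r _ (i := j.castSucc) (j := j.succ) (Fin.castSucc_lt_succ).ne ?_
    rw [Function.update_self, Function.update_of_ne (Fin.castSucc_lt_succ).ne',
      Function.update_of_ne]
    · simp
    · intro h'; have := congrArg Fin.val h'; simp at this; omega
  · have hj : (j : ℕ) + 1 = m := by omega
    have hne : j.castSucc ≠ Fin.last m := (Fin.castSucc_lt_last j).ne
    rw [Sj, ← dt_swap r _ hne]
    congr 1
    ext1 l
    by_cases h1 : l = j.castSucc
    · subst h1
      simp [Function.update_of_ne hne.symm, hj]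
    · by_cases h2 : l = Fin.last m
      · subst h2
        simp [Function.update_of_ne hne.symm]
        omega
      · simp [h1, h2, Equiv.swap_apply_of_ne_of_ne h1 h2]

lemma dA0 (c : Fin (m + 1) → ℝ)
    (hD : ∀ i j, derivative (r i j) = r i (j + 1) - C (c i) * r i j) :
    derivative (A0 r) = A1 r - C (∑ i, c i) * A0 r := by
  rw [A0, derivative_dt r c hD, Fin.sum_univ_castSucc]
  simp only [Fin.val_castSucc, succ_zero, Finset.sum_const_zero, zero_add]
  rfl

lemma dA1 (c : Fin (m + 1) → ℝ)
    (hD : ∀ i j, derivative (r i j) = r i (j + 1) - C (c i) * r i j) :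
    derivative (A1 r) = A2 r - ∑ j, Sj r j - C (∑ i, c i) * A1 r := by
  rw [A1, derivative_dt r c hD, Fin.sum_univ_castSucc]
  have : ∀ j : Fin m, Function.update (fun j : Fin (m+1) => (j : ℕ)) (Fin.last m) (m + 1)
      j.castSucc = j := fun j => by
    rw [Function.update_of_ne (Fin.castSucc_lt_last j).ne]; simp
  simp only [this, Sj_eq, Function.update_self, Function.update_idem, Finset.sum_neg_distrib]
  rw [A2]
  ring

lemma traceA (a : ℝ) (lam : Fin (m + 1) → ℝ)
    (hO : ∀ i j, X * r i (j + 2) + (C (a + 1 + j) - X) * r i (j + 1)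
      + C (lam i - j) * r i j = 0) :
    X * (A2 r + ∑ j, Sj r j) + (C (a + 1 + m) - X) * A1 r
      + C (∑ i, lam i - ∑ j : Fin (m + 1), (j : ℝ)) * A0 r = 0 := by
  have h := sum_det_eigen (Matrix.of fun i (j : Fin (m+1)) => r i j) (fun i => C (lam i))
  rw [← map_sum] at h
  have key : ∀ j : Fin (m+1), ((Matrix.of fun i (j : Fin (m+1)) => r i j).updateCol j
      (fun i => C (lam i) * (Matrix.of fun i (j : Fin (m+1)) => r i j) i j)).det =
      - X * dt r (Function.update (fun j => (j : ℕ)) j ((j : ℕ) + 2))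
      + (X - C (a + 1 + j)) * dt r (Function.update (fun j => (j : ℕ)) j ((j : ℕ) + 1))
      + C (j : ℝ) * A0 r := by
    intro j
    have h0 : A0 r = dt r (Function.update (fun j => (j : ℕ)) j (j : ℕ)) := by
      rw [A0, Function.update_eq_self]
    rw [h0, dt_update, dt_update, dt_update, ← Matrix.det_updateCol_smul,
      ← Matrix.det_updateCol_smul, ← Matrix.det_updateCol_smul, ← Matrix.det_updateCol_add,
      ← Matrix.det_updateCol_add]
    congr 2
    ext1 i
    have := hO i j
    simp only [C_sub] at this
    simp only [Matrix.of_apply, Pi.add_apply, Pi.smul_apply, smul_eq_mul]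
    linear_combination this
  simp only [key] at h
  rw [Finset.sum_add_distrib, ← Finset.sum_mul, ← map_sum, Fin.sum_univ_castSucc] at h
  simp only [Fin.val_castSucc, succ_zero, mul_zero, add_zero, ← Finset.mul_sum, Fin.val_last] at h
  change - X * ∑ j, Sj r j + (-X * A2 r + (X - C (a + 1 + m)) * A1 r) + _ = _ * A0 r at h
  rw [C_sub]
  linear_combination -h

end generic

lemma plucker {m : ℕ} (r : Fin (m + 2) → ℕ → ℝ[X]) :
    A1 r * A1 (fun i : Fin (m + 1) => r i.succ)
      + Sj r (Fin.last m) * A0 (fun i : Fin (m + 1) => r i.succ)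
      = A0 r * A2 (fun i : Fin (m + 1) => r i.succ) := by
  set r' : Fin (m + 1) → ℕ → ℝ[X] := fun i => r i.succ with hr'
  set A : Matrix (Fin (m+2)) (Fin (m+2)) ℝ[X] := Matrix.of fun i j => r i j with hA
  set M' : Matrix (Fin (m+1)) (Fin (m+1)) ℝ[X] := Matrix.of fun i j => r' i j with hM'
  have hc := Matrix.mulVec_cramer A (fun i => r i (m + 2))
  have hcr : ∀ j : Fin (m+2), Matrix.cramer A (fun i => r i (m + 2)) j =
      dt r (Function.update (fun j => (j : ℕ)) j (m + 2)) := by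
    intro j; rw [dt_update, Matrix.cramer_apply]
  have hl : ∀ p : ℕ, Matrix.cramer M' (fun i => r' i p) (Fin.last m) =
      dt r' (Function.update (fun j => (j : ℕ)) (Fin.last m) p) := by
    intro j; rw [dt_update, Matrix.cramer_apply]
  have h2 : ∑ j : Fin (m+2), Matrix.cramer A (fun i => r i (m + 2)) j •
      (fun i => r' i j) = A.det • (fun i => r' i (m + 2)) := by
    ext1 i
    have := congrFun hc i.succ
    simp only [Matrix.mulVec, dotProduct] at this
    simp only [Finset.sum_apply, Pi.smul_apply, smul_eq_mul] at this ⊢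
    rw [← this]
    refine Finset.sum_congr rfl fun j _ => ?_
    rw [mul_comm]; rfl
  have h3 := congrFun (congrArg (Matrix.cramer M') h2) (Fin.last m)
  rw [map_sum] at h3
  simp only [map_smul, Finset.sum_apply, Pi.smul_apply, smul_eq_mul, hl, hcr] at h3
  rw [Fin.sum_univ_castSucc, Fin.sum_univ_castSucc] at h3
  rw [Finset.sum_eq_zero, zero_add] at h3
  · have e : A0 r' = dt r' (Function.update (fun j => (j : ℕ)) (Fin.last m) m) := by
      rw [A0]; congr 1; ext1 l
      by_cases h : l = Fin.last m
      · subst h; simp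
      · simp [h]
    simp only [Fin.val_castSucc, Fin.val_last] at h3
    rw [e]
    change _ * _ + A1 r * A1 r' = A0 r * A2 r' at h3
    rw [← h3, add_comm]
    rfl
  · intro j _
    have hne : j.castSucc ≠ Fin.last m := (Fin.castSucc_lt_last j).ne
    rw [dt_eq_zero r' _ hne, mul_zero]
    rw [Function.update_self, Function.update_of_ne hne]
    simp

lemma main_bilinear (k : ℕ) (hk : 0 < k) (r : Fin (k + 1) → ℕ → ℝ[X]) (a : ℝ)
    (c lam : Fin (k + 1) → ℝ)
    (hD : ∀ i j, derivative (r i j) = r i (j + 1) - C (c i) * r i j)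
    (hO : ∀ i j, X * r i (j + 2) + (C (a + 1 + j) - X) * r i (j + 1)
      + C (lam i - j) * r i j = 0) (hc : c 0 = 0) (y W : ℝ[X])
    (hy : y = Matrix.det (Matrix.of fun i j : Fin (k + 1) => r i j))
    (hW : W = Matrix.det (Matrix.of fun i j : Fin k => r i.succ j)) :
    X * (derivative (derivative y) * W - 2 * derivative y * derivative W
        + y * derivative (derivative W))
      + (C (a + k + 1) - X) * derivative y * W + (X - C (a + k)) * derivative W * y
      + C (lam 0 - k + ∑ i : Fin k, c i.succ) * y * W = 0 := by
  obtain ⟨m, rfl⟩ : ∃ m, k = m + 1 := ⟨k - 1, by omega⟩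
  change y = A0 r at hy
  set r' : Fin (m + 1) → ℕ → ℝ[X] := fun i => r i.succ with hr'
  change W = A0 r' at hW
  have hD' : ∀ i j, derivative (r' i j) = r' i (j + 1) - C (c i.succ) * r' i j :=
    fun i j => hD _ _
  have hS : ∑ j, Sj r j = Sj r (Fin.last m) := by
    rw [Fin.sum_univ_castSucc, Finset.sum_eq_zero, zero_add]
    intro j _
    exact Sj_zero r _ (by simp)
  have y1 := dA0 r c hD
  have y2 := dA1 r c hD
  have y3 := traceA r a lam hO
  have w1 := dA0 r' (fun i => c i.succ) hD'
  have w2 := dA1 r' (fun i => c i.succ) hD'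
  have w3 := traceA r' a (fun i => lam i.succ) (fun i j => hO _ _)
  have hp := plucker r
  rw [hS] at y2 y3
  rw [Fin.sum_univ_succ, hc, zero_add] at y1 y2
  rw [Fin.sum_univ_succ, Fin.sum_univ_castSucc (n := m + 1)] at y3
  simp only [Fin.val_castSucc, Fin.val_last] at y3
  subst hy hW
  rw [y1, w1]
  simp only [derivative_sub, derivative_mul, derivative_C, zero_mul, zero_add, y1, y2, w1, w2]
  simp only [C_add, C_sub, Nat.cast_add, Nat.cast_one, C_1] at *
  linear_combination A0 r' * y3 - A0 r * w3 - 2 * X * hp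

/-! ### Laguerre polynomials -/

lemma gbinom_succ (t : ℝ) (j : ℕ) : gbinom t (j + 1) * (j + 1) = gbinom t j * (t - j) := by
  have h1 : ((j : ℝ) + 1) ≠ 0 := by positivity
  have h2 : (Nat.factorial j : ℝ) ≠ 0 := by positivity
  unfold gbinom
  rw [Finset.prod_range_succ, Nat.factorial_succ]
  push_cast
  field_simp

lemma gbinom_pascal (t : ℝ) (j : ℕ) : gbinom (t + 1) (j + 1) = gbinom t j + gbinom t (j + 1) := by
  have h1 : ((j : ℝ) + 1) ≠ 0 := by positivity
  have h2 : (Nat.factorial j : ℝ) ≠ 0 := by positivity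
  have h3 : gbinom (t + 1) (j + 1) * (j + 1) = gbinom t j * (t + 1) := by
    unfold gbinom
    rw [Finset.prod_range_succ', Nat.factorial_succ]
    push_cast
    have : ∀ i ∈ Finset.range j, (t + 1 - ((i : ℝ) + 1)) = t - i := fun i _ => by ring
    rw [Finset.prod_congr rfl this]
    field_simp
    ring
  have h4 := gbinom_succ t j
  apply mul_right_cancel₀ h1
  linear_combination h3 - h4

lemma coeff_lag (a : ℝ) (n i : ℕ) : (lag a n).coeff i =
    if i ≤ n then (-1 : ℝ) ^ i / (Nat.factorial i : ℝ) * gbinom ((n : ℝ) + a) (n - i) else 0 := by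
  unfold lag
  simp only [finsetSum_coeff, coeff_C_mul, coeff_X_pow]
  simp

lemma derivative_lag (a : ℝ) (n : ℕ) : derivative (lag a n) = lag a n - lag (a + 1) n := by
  ext i
  rw [coeff_derivative, coeff_sub, coeff_lag, coeff_lag, coeff_lag]
  have h2 : (Nat.factorial i : ℝ) ≠ 0 := by positivity
  have h1 : ((i : ℝ) + 1) ≠ 0 := by positivity
  rcases lt_trichotomy i n with h | h | h
  · obtain ⟨d, rfl⟩ : ∃ d, n = i + d + 1 := ⟨n - i - 1, by omega⟩
    rw [if_pos (by omega), if_pos (by omega), if_pos (by omega),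
      show i + d + 1 - (i + 1) = d by omega, show i + d + 1 - i = d + 1 by omega, ← add_assoc,
      gbinom_pascal, Nat.factorial_succ, pow_succ]
    push_cast
    field_simp
    ring
  · subst h
    simp [gbinom]
  · rw [if_neg (by omega), if_neg (by omega), if_neg (by omega)]
    simp

lemma ode_lag (a : ℝ) (n : ℕ) : X * derivative (derivative (lag a n))
    + (C (a + 1) - X) * derivative (lag a n) + C (n : ℝ) * lag a n = 0 := by
  have key : ∀ i : ℕ, ((i : ℝ) + 1) * (i + a + 1) * (lag a n).coeff (i + 1) =
      - (n - i) * (lag a n).coeff i := by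
    intro i
    rw [coeff_lag, coeff_lag]
    have h2 : (Nat.factorial i : ℝ) ≠ 0 := by positivity
    have h1 : ((i : ℝ) + 1) ≠ 0 := by positivity
    rcases lt_trichotomy i n with h | h | h
    · obtain ⟨d, rfl⟩ : ∃ d, n = i + d + 1 := ⟨n - i - 1, by omega⟩
      rw [if_pos (by omega), if_pos (by omega),
        show i + d + 1 - (i + 1) = d by omega, show i + d + 1 - i = d + 1 by omega,
        Nat.factorial_succ, pow_succ]
      have := gbinom_succ (((i + d + 1 : ℕ) : ℝ) + a) d
      push_cast at this ⊢
      field_simp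
      linear_combination this
    · subst h
      simp
    · rw [if_neg (by omega), if_neg (by omega)]
      simp
  ext i
  rw [sub_mul]
  cases i with
  | zero =>
    have := key 0
    simp [coeff_derivative, coeff_X_mul_zero] at this ⊢
    linear_combination this
  | succ i =>
    have := key (i + 1)
    simp only [coeff_add, coeff_sub, coeff_X_mul, coeff_C_mul, coeff_derivative, coeff_zero]
    push_cast at this ⊢
    linear_combination this

lemma iterDeriv_succ (j : ℕ) (p : ℝ[X]) : iterDeriv (j + 1) p = derivative (iterDeriv j p) := by
  simp [iterDeriv, Function.iterate_succ_apply']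

lemma ode_iter (a : ℝ) (n j : ℕ) : X * iterDeriv (j + 2) (lag a n)
    + (C (a + 1 + j) - X) * iterDeriv (j + 1) (lag a n)
    + C ((n : ℝ) - j) * iterDeriv j (lag a n) = 0 := by
  induction j with
  | zero => simpa [iterDeriv] using ode_lag a n
  | succ j ih =>
    have h := congrArg derivative ih
    simp only [derivative_add, derivative_mul, derivative_sub, derivative_X, derivative_C,
      derivative_zero, ← iterDeriv_succ] at h
    push_cast
    simp only [C_add, C_sub, C_1] at h ⊢
    linear_combination h

lemma derivative_lag_comp (a : ℝ) (n : ℕ) : derivative ((lag a n).comp (-X)) =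
    (lag (a + 1) n).comp (-X) - (lag a n).comp (-X) := by
  rw [derivative_comp, derivative_lag]
  simp

lemma ode_lag_comp (a : ℝ) (n : ℕ) : X * (lag (a + 2) n).comp (-X)
    + (C (a + 1) - X) * (lag (a + 1) n).comp (-X)
    + C (- (a + 1 + n)) * (lag a n).comp (-X) = 0 := by
  have h := ode_lag a n
  have h1 := derivative_lag a n
  have h2 := derivative_lag (a + 1) n
  rw [h1, derivative_sub, h1, h2, show a + 1 + 1 = a + 2 by ring] at h
  have h3 := congrArg (fun p => p.comp (-X)) h
  simp only [add_comp, mul_comp, sub_comp, X_comp, C_comp, zero_comp] at h3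
  simp only [C_add, C_neg] at *
  linear_combination -h3

noncomputable def rows (α : ℝ) (F1 F2 : Finset ℕ) (p : ℕ) (i j : ℕ) : ℝ[X] :=
  if i = 0 then iterDeriv j (lag α p)
    else if i - 1 < F1.card then iterDeriv j (lag α (nth F1 (i - 1)))
    else (lag (α + (j : ℝ)) (nth F2 (i - 1 - F1.card))).comp (-Polynomial.X)

lemma bilinear_lag (α : ℝ) (F1 F2 : Finset ℕ) (hk : 0 < F1.card + F2.card) (n : ℕ) :
    X * (derivative (derivative (lagExc α F1 F2 n)) * OmegaL α F1 F2
        - 2 * derivative (lagExc α F1 F2 n) * derivative (OmegaL α F1 F2)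
        + lagExc α F1 F2 n * derivative (derivative (OmegaL α F1 F2)))
      + (C (α + (F1.card + F2.card : ℕ) + 1) - X) * derivative (lagExc α F1 F2 n) * OmegaL α F1 F2
      + (X - C (α + (F1.card + F2.card : ℕ))) * derivative (OmegaL α F1 F2) * lagExc α F1 F2 n
      + C (((n - uF F1 F2 : ℕ) : ℝ) - F1.card) * lagExc α F1 F2 n * OmegaL α F1 F2 = 0 := by
  have h := main_bilinear (F1.card + F2.card) hk
    (fun i j => rows α F1 F2 (n - uF F1 F2) i j) α
    (fun i => if (i : ℕ) = 0 then 0 else if (i : ℕ) - 1 < F1.card then 0 else 1)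
    (fun i => if (i : ℕ) = 0 then ((n - uF F1 F2 : ℕ) : ℝ)
      else if (i : ℕ) - 1 < F1.card then (nth F1 ((i : ℕ) - 1) : ℝ)
      else - (α + 1 + nth F2 ((i : ℕ) - 1 - F1.card)))
    ?_ ?_ (by simp) (lagExc α F1 F2 n) (OmegaL α F1 F2) rfl ?_
  · have hs : ∑ i : Fin (F1.card + F2.card), (if ((i.succ : Fin _) : ℕ) = 0 then (0 : ℝ)
        else if ((i.succ : Fin _) : ℕ) - 1 < F1.card then 0 else 1) = F2.card := by
      rw [Fin.sum_univ_add]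
      simp
    simp only [hs] at h
    convert h using 4
    simp
    ring
  · intro i j
    simp only [rows]
    split_ifs
    · simp [iterDeriv_succ]
    · simp [iterDeriv_succ]
    · rw [derivative_lag_comp]
      push_cast
      simp [add_assoc]
  · intro i j
    simp only [rows]
    split_ifs
    · exact ode_iter _ _ _
    · exact ode_iter _ _ _
    · have := ode_lag_comp (α + j) (nth F2 ((i : ℕ) - 1 - F1.card))
      push_cast
      convert this using 4 <;> ring_nf
  · simp [OmegaL, rows]

/-- Theorem 5.1: the polynomials `L_n^{α;𝓕}`, `n ∈ σ_𝓕`, are eigenfunctions, with eigenvalue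
`-n`, of the second order differential operator `D_𝓕` (at every real `x` with
`Ω_𝓕^α(x) ≠ 0`). -/
theorem laguerre_exceptional_differential_eq (α : ℝ) (hα : ∀ n : ℕ, α ≠ -((n : ℝ) + 1))
    (F1 F2 : Finset ℕ) (hF1 : ∀ f ∈ F1, 0 < f) (hF2 : ∀ f ∈ F2, 0 < f)
    (hne : F1.Nonempty ∨ F2.Nonempty)
    (n : ℕ) (hn : n ∈ sigmaF F1 F2) (x : ℝ) (hΩ : (OmegaL α F1 F2).eval x ≠ 0) :
    x * (Polynomial.derivative (Polynomial.derivative (lagExc α F1 F2 n))).eval x +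
      (α + ((F1.card + F2.card : ℕ) : ℝ) + 1 - x -
          2 * x * (Polynomial.derivative (OmegaL α F1 F2)).eval x / (OmegaL α F1 F2).eval x) *
        (Polynomial.derivative (lagExc α F1 F2 n)).eval x +
      (-(F1.card : ℝ) - (uF F1 F2 : ℝ) +
          (x - α - ((F1.card + F2.card : ℕ) : ℝ)) *
            (Polynomial.derivative (OmegaL α F1 F2)).eval x / (OmegaL α F1 F2).eval x +
          x * (Polynomial.derivative (Polynomial.derivative (OmegaL α F1 F2))).eval x /
            (OmegaL α F1 F2).eval x) *
        (lagExc α F1 F2 n).eval x =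
      -(n : ℝ) * (lagExc α F1 F2 n).eval x := by
  have hk : 0 < F1.card + F2.card := by
    rcases hne with h | h
    · have := h.card_pos; omega
    · have := h.card_pos; omega
  have h := congrArg (Polynomial.eval x) (bilinear_lag α F1 F2 hk n)
  simp only [eval_add, eval_sub, eval_mul, eval_X, eval_C, eval_zero, eval_ofNat] at h
  rw [Nat.cast_sub hn.1] at h
  field_simp
  linear_combination h
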